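/- Suppose {b_{i_1}, …, b_{i_{n*}}} ⊆ {b_1, …, b_{n_B}} is a subset such that any min(n*, u_1) of its elements are linearly independent over F, and fix v with 1 ≤ v ≤ n*. Then there exist D1, an orthogonal array OA(s^u, v·s^{u−u_1}, s, 2), and D2, a Latin hypercube LHD(s^u, g(v)), such that (D1, D2) is a marginally coupled design and D2 is a non-cascading Latin hypercube. -/

import Mathlib

/-- `D` is an orthogonal array OA(n, m, s, t): in any `t` distinct columns,
every `t`-tuple of levels occurs in exactly `n / s^t` rows. -/
def IsOA (n m s t : ℕ) (D : Fin n → Fin m → Fin s) : Prop :=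
  ∀ cols : Fin t → Fin m, Function.Injective cols →
    ∀ lvl : Fin t → Fin s,
      {i : Fin n | ∀ r, D i (cols r) = lvl r}.ncard = n / s ^ t

/-- `D` is a Latin hypercube LHD(n, k): each column is a permutation of `{0, …, n-1}`. -/
def IsLHD (n k : ℕ) (D : Fin n → Fin k → Fin n) : Prop :=
  ∀ j, Function.Bijective fun i => D i j

/-- `(D1, D2)` is a marginally coupled design: for every column `c` of `D1`,
every level `ℓ`, and every column `j` of `D2`, the values `⌊D2 i j / s⌋` over
the rows `i` with `D1 i c = ℓ` are pairwise distinct. -/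
def IsMCD (n m k s : ℕ) (D1 : Fin n → Fin m → Fin s) (D2 : Fin n → Fin k → Fin n) : Prop :=
  ∀ (c : Fin m) (ℓ : Fin s) (j : Fin k) (i i' : Fin n),
    D1 i c = ℓ → D1 i' c = ℓ → (D2 i j : ℕ) / s = (D2 i' j : ℕ) / s → i = i'

/-- `D2` is non-cascading: no two distinct columns of the array with entries
`⌊D2 i j / s⌋` can be obtained from each other by a permutation of the levels
`{0, …, n/s - 1}`. -/
def NonCascading (n k s : ℕ) (D2 : Fin n → Fin k → Fin n) : Prop :=
  ∀ j j' : Fin k, j ≠ j' →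
    ¬ ∃ π : ℕ → ℕ, Set.BijOn π (Set.Iio (n / s)) (Set.Iio (n / s)) ∧
      ∀ i, (D2 i j : ℕ) / s = π ((D2 i j' : ℕ) / s)

/-- The count `f(v)` of the paper: `f(v) = (s-1)^v s^(u₁-v)` for `1 ≤ v ≤ u₁`, and
`f(v) = s^{u₁} Σ_{i=0}^{u₁} (-1)^i C(v,i) s^{-i} + Σ_{i=u₁+1}^v (-1)^i C(v,i)`
for `v > u₁` (written with integer arithmetic). -/
def fCount (s u₁ v : ℕ) : ℤ :=
  if v ≤ u₁ then ((s : ℤ) - 1) ^ v * (s : ℤ) ^ (u₁ - v)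
  else (∑ i ∈ Finset.range (u₁ + 1), (-1) ^ i * (v.choose i : ℤ) * (s : ℤ) ^ (u₁ - i))
    + ∑ i ∈ Finset.Icc (u₁ + 1) v, (-1) ^ i * (v.choose i : ℤ)

open Finset in
/-- The fibres of a surjective system of linear forms all have the same size. -/
theorem card_filter_dotProduct_eq {F : Type*} [Field F] [Fintype F] [DecidableEq F]
    {κ : Type*} [Fintype κ] {m : ℕ} {a : κ → Fin m → F} (ha : LinearIndependent F a) (c : κ → F) :
    #{y : Fin m → F | ∀ k, a k ⬝ᵥ y = c k} * Fintype.card F ^ Fintype.card κ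
      = Fintype.card F ^ m := by
  classical
  have hrank : (Matrix.of a).rank = Fintype.card κ := LinearIndependent.rank_matrix ha
  have hsurj : Function.Surjective (Matrix.of a).mulVecLin := by
    rw [← LinearMap.range_eq_top]
    apply Submodule.eq_top_of_finrank_eq
    rw [Module.finrank_fintype_fun_eq_card]
    exact hrank
  have hfib : ∀ c' ∈ (univ : Finset (κ → F)),
      #{y : Fin m → F | (Matrix.of a).mulVecLin y = c'}
        = #{y : Fin m → F | (Matrix.of a).mulVecLin y = c} := fun c' _ =>
    AddMonoidHom.card_fiber_eq_of_mem_range (Matrix.of a).mulVecLin (hsurj c') (hsurj c)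
  have htotal := card_eq_sum_card_fiberwise (s := (univ : Finset (Fin m → F)))
    (t := (univ : Finset (κ → F))) (f := (Matrix.of a).mulVecLin) (fun _ _ => mem_coe.2 (mem_univ _))
  rw [sum_congr rfl hfib, sum_const, card_univ, card_univ, Fintype.card_fun, Fintype.card_fun,
    Fintype.card_fin, smul_eq_mul] at htotal
  rw [htotal, mul_comm]
  congr 2
  ext y
  simp only [mem_filter, mem_univ, true_and]
  exact ⟨fun h => funext h, fun h k => congrFun h k⟩

open Finset in
/-- The common kernel of `i` linear forms in general position on `F^m` has `|F|^(m-i)` elements,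
the exponent being truncated at zero. -/
theorem card_filter_dotProduct_eq_zero {F : Type*} [Field F] [Fintype F] [DecidableEq F]
    {κ : Type*} {m : ℕ} {a : κ → Fin m → F}
    (ha : ∀ T : Finset κ, #T ≤ m → LinearIndependent F fun t : T => a t) (T : Finset κ) :
    #{y : Fin m → F | ∀ k ∈ T, a k ⬝ᵥ y = 0} = Fintype.card F ^ (m - #T) := by
  have hpos : 0 < Fintype.card F := Fintype.card_pos
  have key : ∀ T : Finset κ, #T ≤ m →
      #{y : Fin m → F | ∀ k ∈ T, a k ⬝ᵥ y = 0} = Fintype.card F ^ (m - #T) := by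
    intro T hT
    have h := card_filter_dotProduct_eq (ha T hT) 0
    simp only [Subtype.forall, Pi.zero_apply, Fintype.card_coe] at h
    refine Nat.eq_of_mul_eq_mul_right (pow_pos hpos #T) ?_
    rw [h, ← pow_add, Nat.sub_add_cancel hT]
  rcases le_total #T m with hT | hT
  · exact key T hT
  · obtain ⟨T', hsub, hcard⟩ := exists_subset_card_eq hT
    have h' := key T' hcard.le
    rw [hcard, Nat.sub_self] at h'
    rw [Nat.sub_eq_zero_of_le hT]
    refine le_antisymm ((card_le_card fun y => ?_).trans h'.le) ?_
    · simp only [mem_filter, mem_univ, true_and]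
      exact fun h k hk => h k (hsub hk)
    · rw [pow_zero, Nat.one_le_iff_ne_zero, ← Nat.pos_iff_ne_zero, card_pos]
      exact ⟨0, by simp⟩

/-- `fCount` as a single alternating sum with truncated exponents. -/
theorem fCount_eq_sum (s m v : ℕ) :
    fCount s m v = ∑ i ∈ Finset.range (v + 1), (v.choose i : ℤ) * ((-1) ^ i * (s : ℤ) ^ (m - i)) := by
  unfold fCount
  split_ifs with h
  · have hb := add_pow (-1 : ℤ) (s : ℤ) v
    rw [show (s : ℤ) - 1 = -1 + s by ring, hb, Finset.sum_mul]
    refine Finset.sum_congr rfl fun i hi => ?_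
    have hi' : i ≤ v := Nat.lt_succ_iff.1 (Finset.mem_range.1 hi)
    rw [show m - i = (v - i) + (m - v) by omega, pow_add]
    ring
  · have hv : m + 1 ≤ v + 1 := by omega
    rw [← Finset.sum_range_add_sum_Ico _ hv]
    congr 1
    · exact Finset.sum_congr rfl fun i _ => by ring
    · refine Finset.sum_congr (by ext; simp) fun i hi => ?_
      have : m - i = 0 := by have := Finset.mem_Ico.1 hi; omega
      rw [this]
      ring

open Finset in
/-- The number of points of `F^m` avoiding `v` hyperplanes in general position. -/
theorem card_filter_dotProduct_ne_zero {F : Type*} [Field F] [Fintype F] [DecidableEq F]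
    {m v : ℕ} {a : Fin v → Fin m → F}
    (ha : ∀ T : Finset (Fin v), #T ≤ m → LinearIndependent F fun t : T => a t) :
    (#{y : Fin m → F | ∀ k, a k ⬝ᵥ y ≠ 0} : ℤ) = fCount (Fintype.card F) m v := by
  classical
  have h := inclusion_exclusion_card_inf_compl (univ : Finset (Fin v))
    fun k => ({y : Fin m → F | a k ⬝ᵥ y = 0} : Finset (Fin m → F))
  have hT : ∀ T : Finset (Fin v),
      (T.inf fun k => ({y : Fin m → F | a k ⬝ᵥ y = 0} : Finset (Fin m → F)))
        = ({y : Fin m → F | ∀ k ∈ T, a k ⬝ᵥ y = 0} : Finset (Fin m → F)) := by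
    intro T; ext y; simp [mem_inf]
  have hL : (univ.inf fun k => ({y : Fin m → F | a k ⬝ᵥ y = 0} : Finset (Fin m → F))ᶜ)
      = ({y : Fin m → F | ∀ k, a k ⬝ᵥ y ≠ 0} : Finset (Fin m → F)) := by
    ext y; simp [mem_inf]
  have hS : ∀ T : Finset (Fin v), #{y : Fin m → F | ∀ k ∈ T, a k ⬝ᵥ y = 0}
      = Fintype.card F ^ (m - #T) := fun T => by
    convert card_filter_dotProduct_eq_zero ha T
  simp only [hT, hL, hS] at h
  push_cast at h
  rw [h, sum_powerset_apply_card
    (fun i => (-1 : ℤ) ^ i * (Fintype.card F : ℤ) ^ (m - i)), fCount_eq_sum]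
  simp

open Finset in
/-- Scaling: the points avoiding the hyperplanes fall into orbits of size `|F| - 1`, each meeting
the affine hyperplane `a k₀ ⬝ᵥ y = 1` exactly once. -/
theorem card_filter_dotProduct_normalized {F : Type*} [Field F] [Fintype F] [DecidableEq F]
    {m v : ℕ} (a : Fin v → Fin m → F) (k₀ : Fin v) :
    #{y : Fin m → F | (∀ k, a k ⬝ᵥ y ≠ 0) ∧ a k₀ ⬝ᵥ y = 1} * (Fintype.card F - 1)
      = #{y : Fin m → F | ∀ k, a k ⬝ᵥ y ≠ 0} := by
  classical
  rw [← Fintype.card_units, ← card_univ (α := Fˣ), ← card_product]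
  refine card_nbij' (fun p => p.2 • p.1)
    (fun y => if h : a k₀ ⬝ᵥ y = 0 then (y, 1) else ((a k₀ ⬝ᵥ y)⁻¹ • y, Units.mk0 _ h)) ?_ ?_ ?_ ?_
  · rintro ⟨y, c⟩ hy
    simp only [mem_coe, mem_product, mem_filter, mem_univ, true_and, and_true] at hy
    simp only [coe_filter, mem_univ, true_and, Set.mem_ofPred_eq, Units.smul_def, dotProduct_smul,
      smul_eq_mul]
    exact fun k => mul_ne_zero c.ne_zero (hy.1 k)
  · intro y hy
    simp only [coe_filter, mem_univ, true_and, Set.mem_ofPred_eq] at hy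
    simp only [hy k₀, dif_neg, not_false_eq_true, mem_coe, mem_product, mem_filter, mem_univ,
      true_and, and_true, dotProduct_smul, smul_eq_mul]
    exact ⟨fun k => mul_ne_zero (inv_ne_zero (hy k₀)) (hy k), inv_mul_cancel₀ (hy k₀)⟩
  · rintro ⟨y, c⟩ hy
    simp only [mem_product, mem_filter, mem_univ, true_and, and_true, mem_coe] at hy
    have h1 : a k₀ ⬝ᵥ (c • y) = c := by
      rw [Units.smul_def, dotProduct_smul, hy.2, smul_eq_mul, mul_one]
    simp only [h1, c.ne_zero, dif_neg, not_false_eq_true, Prod.mk.injEq]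
    refine ⟨?_, Units.ext rfl⟩
    rw [Units.smul_def, inv_smul_smul₀ c.ne_zero]
  · intro y hy
    simp only [coe_filter, mem_univ, true_and, Set.mem_ofPred_eq] at hy
    simp only [hy k₀, dif_neg, not_false_eq_true, Units.smul_def, Units.val_mk0]
    exact smul_inv_smul₀ (hy k₀) y

/-- The points of a finite vector space can be numbered so that dividing the labels by `|F|` yields
labels for the lines parallel to a given nonzero vector. -/
theorem exists_equiv_fin_div_eq_iff {F V : Type*} [Field F] [Fintype F] [AddCommGroup V]
    [Module F V] [Finite V] {n : ℕ} (hn : Nat.card V = n) {x : V} {φ : V →ₗ[F] F} (hx : φ x = 1) :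
    ∃ e : V ≃ Fin n, ∀ y y', (e y : ℕ) / Fintype.card F = (e y' : ℕ) / Fintype.card F ↔
      ∃ c : F, c • x = y - y' := by
  classical
  have hpos : 0 < Fintype.card F := Fintype.card_pos
  let L := F ∙ x
  have : Finite (V ⧸ L) := Finite.of_surjective _ (Submodule.mkQ_surjective L)
  let f : V → (V ⧸ L) × F := fun y => (Submodule.Quotient.mk y, φ y)
  have hx0 : x ≠ 0 := fun h => by simp [h] at hx
  have hf : Function.Injective f := by
    intro y y' h
    obtain ⟨h1, h2⟩ := Prod.mk.inj h
    rw [Submodule.Quotient.eq, Submodule.mem_span_singleton] at h1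
    obtain ⟨c, hc⟩ := h1
    have h3 := congrArg φ hc
    rw [map_smul, hx, map_sub, h2, sub_self, smul_eq_mul, mul_one] at h3
    rw [h3, zero_smul] at hc
    exact sub_eq_zero.1 hc.symm
  have hL : Nat.card L = Nat.card F :=
    (Nat.card_congr (LinearEquiv.toSpanNonzeroSingleton F V x hx0).toEquiv).symm
  have hcard : Nat.card V = Nat.card (V ⧸ L) * Fintype.card F := by
    rw [Submodule.card_eq_card_quotient_mul_card L, hL, Nat.card_eq_fintype_card, mul_comm]
  have hbij : Function.Bijective f := by
    rw [Nat.bijective_iff_injective_and_card]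
    exact ⟨hf, by rw [hcard, Nat.card_prod, Nat.card_eq_fintype_card (α := F)]⟩
  let q : V ⧸ L ≃ Fin (Nat.card (V ⧸ L)) := Finite.equivFin _
  refine ⟨((Equiv.ofBijective f hbij).trans
    ((q.prodCongr (Fintype.equivFin F)).trans finProdFinEquiv)).trans
      (finCongr (hcard.symm.trans hn)), fun y y' => ?_⟩
  rw [← Submodule.mem_span_singleton, ← Submodule.Quotient.eq]
  simp only [Equiv.trans_apply, finCongr_apply, Fin.val_cast, finProdFinEquiv_apply_val,
    Equiv.prodCongr_apply, Prod.map_fst, Prod.map_snd, Equiv.ofBijective_apply,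
    Nat.add_mul_div_left _ _ hpos, Nat.div_eq_of_lt (Fin.is_lt _), zero_add, f]
  rw [← Fin.ext_iff, q.apply_eq_iff_eq]

/-- Linear forms that are pairwise independent and a family of pairwise independent directions on
which all of them are nonzero give a marginally coupled design. -/
theorem exists_marginallyCoupled {F : Type*} [Field F] [Fintype F] {u m k : ℕ}
    {z : Fin m → Fin u → F} {x : Fin k → Fin u → F} {φ : Fin u → F}
    (hz : ∀ c c', c ≠ c' → LinearIndependent F ![z c, z c'])
    (hx : Function.Injective x) (hφ : ∀ j, φ ⬝ᵥ x j = 1) (hzx : ∀ c j, z c ⬝ᵥ x j ≠ 0) :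
    ∃ (D1 : Fin (Fintype.card F ^ u) → Fin m → Fin (Fintype.card F))
      (D2 : Fin (Fintype.card F ^ u) → Fin k → Fin (Fintype.card F ^ u)),
      IsOA (Fintype.card F ^ u) m (Fintype.card F) 2 D1 ∧
      IsLHD (Fintype.card F ^ u) k D2 ∧
      IsMCD (Fintype.card F ^ u) m k (Fintype.card F) D1 D2 ∧
      NonCascading (Fintype.card F ^ u) k (Fintype.card F) D2 := by
  classical
  have hcard : Nat.card (Fin u → F) = Fintype.card F ^ u := by
    rw [Nat.card_eq_fintype_card, Fintype.card_fun, Fintype.card_fin]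
  let row : Fin (Fintype.card F ^ u) ≃ (Fin u → F) :=
    (Finite.equivFinOfCardEq hcard).symm
  let lev : F ≃ Fin (Fintype.card F) := Fintype.equivFin F
  have hE := fun j => exists_equiv_fin_div_eq_iff hcard (x := x j)
    (φ := dotProductBilin F F φ) (hφ j)
  choose e he using hE
  refine ⟨fun i c => lev (z c ⬝ᵥ row i), fun i j => e j (row i), ?_, ?_, ?_, ?_⟩
  · intro cols hcols lvl
    have hind : LinearIndependent F fun r => z (cols r) := by
      have h := hz (cols 0) (cols 1) (hcols.ne (by decide))
      convert h using 1
      ext r : 1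
      fin_cases r <;> rfl
    have h := card_filter_dotProduct_eq hind fun r => lev.symm (lvl r)
    rw [Fintype.card_fin] at h
    have hset : {i | ∀ r, lev (z (cols r) ⬝ᵥ row i) = lvl r} = row ⁻¹'
        ((Finset.univ.filter fun y : Fin u → F => ∀ r, z (cols r) ⬝ᵥ y = lev.symm (lvl r) :
          Finset (Fin u → F)) : Set (Fin u → F)) := by
      ext i
      simp [Equiv.eq_symm_apply]
    rw [hset, Set.ncard_preimage_of_injective_subset_range row.injective (by simp),
      Set.ncard_coe_finset]
    convert (Nat.div_eq_of_eq_mul_left (pow_pos Fintype.card_pos 2) h.symm).symm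
  · exact fun j => (e j).bijective.comp row.bijective
  · intro c ℓ j i i' h h' hdiv
    obtain ⟨t, ht⟩ := (he j _ _).1 hdiv
    have hzz : z c ⬝ᵥ row i = z c ⬝ᵥ row i' := lev.injective (h.trans h'.symm)
    have h0 := congrArg (z c ⬝ᵥ ·) ht
    simp only [dotProduct_smul, dotProduct_sub, hzz, sub_self, smul_eq_mul, mul_eq_zero,
      hzx c j, or_false] at h0
    rw [h0, zero_smul] at ht
    exact row.injective (sub_eq_zero.1 ht.symm)
  · rintro j j' hjj' ⟨π, -, hπ⟩
    have h' : (e j' (x j') : ℕ) / Fintype.card F = (e j' 0 : ℕ) / Fintype.card F :=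
      (he j' _ _).2 ⟨1, by simp⟩
    have h1 := hπ (row.symm (x j'))
    have h0 := hπ (row.symm 0)
    simp only [Equiv.apply_symm_apply] at h1 h0
    obtain ⟨t, ht⟩ := (he j (x j') 0).1 (by rw [h1, h0, h'])
    rw [sub_zero] at ht
    have h2 := congrArg (φ ⬝ᵥ ·) ht
    simp only [dotProduct_smul, hφ, smul_eq_mul, mul_one] at h2
    rw [h2, one_smul] at ht
    exact hjj' (hx ht)

/-- if `{b_{i₁}, …, b_{i_{n*}}}` is a subset of the `b`-vectors such that any
`min(n*, u₁)` of its elements are linearly independent, and `1 ≤ v ≤ n*`, then with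
`g(v) = f(v)/(s-1)` there exists a marginally coupled design `(D1, D2)` with `D1` an
OA(s^u, v·s^(u-u₁), s, 2) and `D2` a non-cascading LHD(s^u, g(v)). -/
theorem stmt9 {F : Type*} [Field F] [Fintype F]
    (u u₁ nstar : ℕ) (hu₁ : 1 ≤ u₁) (hu : u₁ ≤ u)
    (b : Fin ((Fintype.card F - 1) ^ (u₁ - 1)) → Fin u → F)
    (hb_inj : Function.Injective b)
    (hb_enum : ∀ x : Fin u → F,
      (x ⟨0, by omega⟩ = 1 ∧ (∀ i : Fin u, 1 ≤ (i : ℕ) → (i : ℕ) < u₁ → x i ≠ 0) ∧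
        (∀ i : Fin u, u₁ ≤ (i : ℕ) → x i = 0)) ↔ ∃ t, b t = x)
    (ι : Fin nstar → Fin ((Fintype.card F - 1) ^ (u₁ - 1)))
    (hι : Function.Injective ι)
    (hindep : ∀ T : Finset (Fin nstar), T.card = min nstar u₁ →
      LinearIndependent F (fun t : T => b (ι t.1)))
    (v : ℕ) (hv1 : 1 ≤ v) (hv2 : v ≤ nstar)
    (gv : ℕ) (hgv : (gv : ℤ) * ((Fintype.card F : ℤ) - 1) = fCount (Fintype.card F) u₁ v) :
    ∃ (D1 : Fin (Fintype.card F ^ u) → Fin (v * Fintype.card F ^ (u - u₁)) →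
        Fin (Fintype.card F))
      (D2 : Fin (Fintype.card F ^ u) → Fin gv → Fin (Fintype.card F ^ u)),
      IsOA (Fintype.card F ^ u) (v * Fintype.card F ^ (u - u₁)) (Fintype.card F) 2 D1 ∧
      IsLHD (Fintype.card F ^ u) gv D2 ∧
      IsMCD (Fintype.card F ^ u) (v * Fintype.card F ^ (u - u₁)) gv (Fintype.card F) D1 D2 ∧
      NonCascading (Fintype.card F ^ u) gv (Fintype.card F) D2 := by
  classical
  obtain ⟨d, rfl⟩ := Nat.exists_eq_add_of_le hu
  rw [Nat.add_sub_cancel_left]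
  have hpos : 0 < Fintype.card F := Fintype.card_pos
  let a : Fin v → Fin u₁ → F := fun k i => b (ι (Fin.castLE hv2 k)) (Fin.castAdd d i)
  have hab : ∀ k, Fin.append (a k) 0 = b (ι (Fin.castLE hv2 k)) := by
    intro k
    ext i
    refine Fin.addCases (fun i => by simp [a]) (fun i => ?_) i
    rw [Fin.append_right]
    exact (((hb_enum _).2 ⟨_, rfl⟩).2.2 (Fin.natAdd u₁ i) (by simp)).symm
  have ha1 : ∀ k, a k ⟨0, hu₁⟩ = 1 := fun k => ((hb_enum _).2 ⟨_, rfl⟩).1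
  have ha_inj : Function.Injective a := by
    intro k k' h
    have h' := (hab k).symm.trans ((congrArg (Fin.append · 0) h).trans (hab k'))
    exact Fin.castLE_injective hv2 (hι (hb_inj h'))
  let pad : (Fin u₁ → F) →ₗ[F] (Fin (u₁ + d) → F) :=
    { toFun := fun y => Fin.append y 0
      map_add' := fun y y' => by
        ext i; refine Fin.addCases (fun i => by simp) (fun i => by simp) i
      map_smul' := fun c y => by
        ext i; refine Fin.addCases (fun i => by simp) (fun i => by simp) i }
  have ha : ∀ T : Finset (Fin v), T.card ≤ u₁ → LinearIndependent F fun t : T => a t := by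
    intro T hT
    have hcard : (T.map (Fin.castLEEmb hv2)).card ≤ min nstar u₁ := by
      rw [Finset.card_map]
      exact le_min ((card_finset_fin_le T).trans hv2) hT
    obtain ⟨T', hsub, hT'⟩ := Finset.exists_superset_card_eq hcard
      (by rw [Fintype.card_fin]; exact min_le_left _ _)
    refine LinearIndependent.of_comp pad ?_
    have h := (hindep T' hT').comp
      (fun t : T => ⟨Fin.castLE hv2 t, hsub (Finset.mem_map_of_mem (Fin.castLEEmb hv2) t.2)⟩)
      (fun t t' h => Subtype.ext (Fin.castLE_injective hv2 (congrArg Subtype.val h)))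
    convert h using 1
    ext t : 1
    exact hab t
  let k₀ : Fin v := ⟨0, hv1⟩
  let Y : Finset (Fin u₁ → F) :=
    Finset.univ.filter fun y => (∀ k, a k ⬝ᵥ y ≠ 0) ∧ a k₀ ⬝ᵥ y = 1
  have hY : Y.card = gv := by
    have hsub : 0 < Fintype.card F - 1 := Nat.sub_pos_of_lt Fintype.one_lt_card
    refine Nat.eq_of_mul_eq_mul_right hsub ?_
    rw [show Y.card * _ = _ from card_filter_dotProduct_normalized a k₀]
    zify [hpos]
    rw [card_filter_dotProduct_ne_zero ha, hgv]
  let y := (Y.equivFinOfCardEq hY).symm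
  have hy : ∀ j, (∀ k, a k ⬝ᵥ (y j).1 ≠ 0) ∧ a k₀ ⬝ᵥ (y j).1 = 1 := fun j =>
    (Finset.mem_filter.1 (y j).2).2
  have hdot : ∀ (p q : Fin u₁ → F) (w : Fin d → F), Fin.append p w ⬝ᵥ Fin.append q 0 = p ⬝ᵥ q := by
    intro p q w
    simp [dotProduct, Fin.sum_univ_add]
  let col : Fin (v * Fintype.card F ^ d) ≃ Fin v × (Fin d → F) :=
    finProdFinEquiv.symm.trans
      ((Equiv.refl _).prodCongr (Fintype.equivFinOfCardEq (by simp)).symm)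
  refine exists_marginallyCoupled (z := fun c => Fin.append (a (col c).1) (col c).2)
    (x := fun j => Fin.append (y j).1 0) (φ := Fin.append (a k₀) 0) ?_ ?_ ?_ ?_
  · intro c c' hcc'
    have hne : Fin.append (a (col c).1) (col c).2 ≠ Fin.append (a (col c').1) (col c').2 := by
      intro h
      have h' := (Fin.appendEquiv u₁ d).injective
        (a₁ := (a (col c).1, (col c).2)) (a₂ := (a (col c').1, (col c').2)) h
      obtain ⟨h1, h2⟩ := Prod.mk.inj h'
      exact hcc' (col.injective (Prod.ext (ha_inj h1) h2))
    rw [LinearIndependent.pair_iff]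
    intro p q hpq
    have h0 := congrFun hpq (Fin.castAdd d ⟨0, hu₁⟩)
    simp only [Pi.add_apply, Pi.smul_apply, Fin.append_left, ha1, smul_eq_mul, mul_one,
      Pi.zero_apply] at h0
    obtain rfl := eq_neg_of_add_eq_zero_right h0
    rw [neg_smul, ← sub_eq_add_neg, ← smul_sub, smul_eq_zero, sub_eq_zero] at hpq
    have hp := hpq.resolve_right hne
    exact ⟨hp, by rw [hp, neg_zero]⟩
  · intro j j' h
    have h' := (Fin.appendEquiv u₁ d).injective
      (a₁ := ((y j).1, 0)) (a₂ := ((y j').1, 0)) h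
    exact y.injective (Subtype.ext (congrArg Prod.fst h'))
  · intro j
    rw [hdot]
    exact (hy j).2
  · intro c j
    rw [hdot]
    exact (hy j).1 _
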